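/- ⟨NW⟩ ∘ ⟨NE⟩ = id on V ⊗ V. This is the Kauffman-amplitude identity corresponding to the other flavor of the second Reidemeister move, i.e. the source and target of the elementary transition ET2I = [[0,NE,0][0,NW,0] ⇒ 1₂] have equal Kauffman amplitudes. -/

import Mathlib

set_option synthInstance.maxHeartbeats 1000000
set_option maxHeartbeats 1000000

noncomputable section

open TensorProduct

/-- The ground field `K = ℚ(q)`. -/
abbrev K : Type := RatFunc ℚ

/-- The 2-dimensional `K`-vector space `V` with basis `e 0, e 1`. -/
abbrev V : Type := Fin 2 → K

/-- The indeterminate `q`. -/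
noncomputable def q : K := RatFunc.X

/-- The basis vectors `e₀, e₁` of `V`. -/
noncomputable def e : Fin 2 → V := fun i => Pi.single i (1 : K)

/-- The standard basis of `V`. -/
noncomputable def Vbasis : Module.Basis (Fin 2) K V := Pi.basisFun K (Fin 2)

/-- The induced basis `e i ⊗ e j` of `V ⊗ V`. -/
noncomputable def VVbasis : Module.Basis (Fin 2 × Fin 2) K (V ⊗[K] V) :=
  Vbasis.tensorProduct Vbasis

/-- Kauffman amplitude of `Cup`: `1 ↦ -q·e₀⊗e₁ + q⁻¹·e₁⊗e₀`. -/
noncomputable def Cup : K →ₗ[K] V ⊗[K] V :=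
  LinearMap.toSpanSingleton K (V ⊗[K] V)
    ((-q) • (e 0 ⊗ₜ[K] e 1) + q⁻¹ • (e 1 ⊗ₜ[K] e 0))

/-- Kauffman amplitude of `Cap`: `e₀⊗e₀ ↦ 0`, `e₁⊗e₁ ↦ 0`, `e₀⊗e₁ ↦ q`, `e₁⊗e₀ ↦ -q⁻¹`. -/
noncomputable def Cap : V ⊗[K] V →ₗ[K] K :=
  VVbasis.constr K fun p =>
    if p = (0, 1) then q else if p = (1, 0) then -q⁻¹ else 0

/-- Kauffman amplitude of `NE`. -/
noncomputable def NE : V ⊗[K] V →ₗ[K] V ⊗[K] V :=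
  VVbasis.constr K fun p =>
    if p = (0, 0) then q • (e 0 ⊗ₜ[K] e 0)
    else if p = (1, 1) then q • (e 1 ⊗ₜ[K] e 1)
    else if p = (0, 1) then q⁻¹ • (e 1 ⊗ₜ[K] e 0)
    else q⁻¹ • (e 0 ⊗ₜ[K] e 1) + (q - q⁻¹ ^ 3) • (e 1 ⊗ₜ[K] e 0)

/-- Kauffman amplitude of `NW`. -/
noncomputable def NW : V ⊗[K] V →ₗ[K] V ⊗[K] V :=
  VVbasis.constr K fun p =>
    if p = (0, 0) then q⁻¹ • (e 0 ⊗ₜ[K] e 0)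
    else if p = (1, 1) then q⁻¹ • (e 1 ⊗ₜ[K] e 1)
    else if p = (1, 0) then q • (e 0 ⊗ₜ[K] e 1)
    else (q⁻¹ - q ^ 3) • (e 0 ⊗ₜ[K] e 1) + q • (e 1 ⊗ₜ[K] e 0)

theorem VVbasis_eq (i j : Fin 2) : VVbasis (i, j) = e i ⊗ₜ[K] e j := by
  simp [VVbasis, Vbasis, e, Module.Basis.tensorProduct_apply]

theorem q_ne_zero : q ≠ 0 := RatFunc.X_ne_zero

theorem NW_00 : NW (e 0 ⊗ₜ[K] e 0) = q⁻¹ • (e 0 ⊗ₜ[K] e 0) := by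
  rw [← VVbasis_eq, NW, Module.Basis.constr_basis]
  try rw [VVbasis_eq]
  rfl

theorem NW_11 : NW (e 1 ⊗ₜ[K] e 1) = q⁻¹ • (e 1 ⊗ₜ[K] e 1) := by
  rw [← VVbasis_eq, NW, Module.Basis.constr_basis]
  try rw [VVbasis_eq]
  rfl

theorem NW_10 : NW (e 1 ⊗ₜ[K] e 0) = q • (e 0 ⊗ₜ[K] e 1) := by
  rw [← VVbasis_eq, NW, Module.Basis.constr_basis]
  try rw [VVbasis_eq]
  rfl

theorem NW_01 : NW (e 0 ⊗ₜ[K] e 1) =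
    (q⁻¹ - q ^ 3) • (e 0 ⊗ₜ[K] e 1) + q • (e 1 ⊗ₜ[K] e 0) := by
  rw [← VVbasis_eq, NW, Module.Basis.constr_basis]
  try rw [VVbasis_eq]
  rfl

theorem NE_00 : NE (e 0 ⊗ₜ[K] e 0) = q • (e 0 ⊗ₜ[K] e 0) := by
  rw [← VVbasis_eq, NE, Module.Basis.constr_basis]
  try rw [VVbasis_eq]
  rfl

theorem NE_11 : NE (e 1 ⊗ₜ[K] e 1) = q • (e 1 ⊗ₜ[K] e 1) := by
  rw [← VVbasis_eq, NE, Module.Basis.constr_basis]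
  try rw [VVbasis_eq]
  rfl

theorem NE_01 : NE (e 0 ⊗ₜ[K] e 1) = q⁻¹ • (e 1 ⊗ₜ[K] e 0) := by
  rw [← VVbasis_eq, NE, Module.Basis.constr_basis]
  try rw [VVbasis_eq]
  rfl

theorem NE_10 : NE (e 1 ⊗ₜ[K] e 0) =
    q⁻¹ • (e 0 ⊗ₜ[K] e 1) + (q - q⁻¹ ^ 3) • (e 1 ⊗ₜ[K] e 0) := by
  rw [← VVbasis_eq, NE, Module.Basis.constr_basis]
  try rw [VVbasis_eq]
  rfl

/-- `⟨NW⟩ ∘ ⟨NE⟩ = id` on `V ⊗ V` (Reidemeister II, flavor ET2I). -/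
theorem NW_comp_NE :
    NW ∘ₗ NE = (LinearMap.id : V ⊗[K] V →ₗ[K] V ⊗[K] V) := by
  have hq := q_ne_zero
  apply VVbasis.ext
  rintro ⟨i, j⟩
  rw [VVbasis_eq, LinearMap.comp_apply, LinearMap.id_apply]
  fin_cases i <;> fin_cases j
  · change NW (NE (e 0 ⊗ₜ[K] e 0)) = e 0 ⊗ₜ[K] e 0
    rw [NE_00, map_smul, NW_00, smul_smul, mul_inv_cancel₀ hq, one_smul]
  · change NW (NE (e 0 ⊗ₜ[K] e 1)) = e 0 ⊗ₜ[K] e 1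
    rw [NE_01, map_smul, NW_10, smul_smul, inv_mul_cancel₀ hq, one_smul]
  · change NW (NE (e 1 ⊗ₜ[K] e 0)) = e 1 ⊗ₜ[K] e 0
    rw [NE_10, map_add, map_smul, map_smul, NW_01, NW_10, smul_add, smul_smul, smul_smul,
      smul_smul, inv_mul_cancel₀ hq, one_smul, add_right_comm, ← add_smul]
    have h : q⁻¹ * (q⁻¹ - q ^ 3) + (q - q⁻¹ ^ 3) * q = 0 := by
      field_simp
      ring
    rw [h, zero_smul, zero_add]
  · change NW (NE (e 1 ⊗ₜ[K] e 1)) = e 1 ⊗ₜ[K] e 1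
    rw [NE_11, map_smul, NW_11, smul_smul, mul_inv_cancel₀ hq, one_smul]
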